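/- arXiv:2501.18208 — 4 statements merged into one kernel-verified Lean document; each statement's English description precedes it below -/
import Mathlib

section
/- Let f : [0,1] → [0,∞) be a bounded measurable function with ∫_0^1 f(x) dx = 1, and set 𝓛(t) = ∫_0^1 e^{−t·x} f(x) dx for t ≥ 0. Then there exists a constant c > 0 such that for all t ≥ 0, 𝓛(t) ≤ 1 / (1 + c·t). -/
open MeasureTheory

lemma aux_ineq (s : ℝ) (hs : 0 < s) : (1 - Real.exp (-s)) / s ≤ 1 / (1 + s / 4) := by
  rw [div_le_div_iff₀ hs (by positivity)]
  have h0 := Real.exp_pos (-s)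
  rcases le_total s 2 with h | h
  · have h1 : 1 - s / 2 ≤ Real.exp (-(s / 2)) := by
      have := Real.add_one_le_exp (-(s / 2)); linarith
    have h2 : Real.exp (-s) = Real.exp (-(s / 2)) * Real.exp (-(s / 2)) := by
      rw [← Real.exp_add]; congr 1; ring
    have h3 : (1 - s / 2) * (1 - s / 2) ≤ Real.exp (-s) := by
      rw [h2]; exact mul_self_le_mul_self (by linarith) h1
    have h4 : (1 - Real.exp (-s)) * (1 + s / 4) ≤ (s - s ^ 2 / 4) * (1 + s / 4) :=
      mul_le_mul_of_nonneg_right (by nlinarith) (by positivity)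
    have : 0 ≤ s ^ 3 := by positivity
    nlinarith
  · nlinarith [mul_pos h0 hs]

lemma aux_int (t a : ℝ) (ht : 0 < t) (ha : 0 ≤ a) :
    ∫ x in Set.Icc (0:ℝ) a, Real.exp (-t * x) = (1 - Real.exp (-(t * a))) / t := by
  rw [integral_Icc_eq_integral_Ioc, ← intervalIntegral.integral_of_le ha,
    intervalIntegral.integral_comp_mul_left (fun y => Real.exp y) (neg_ne_zero.2 ht.ne')]
  simp
  field_simp
  ring

/-- If `f` is a bounded probability density on `[0,1]` and `𝓛(t) = ∫_0^1 e^{−tx} f(x) dx`, then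
there exists `c > 0` such that `𝓛(t) ≤ 1 / (1 + c·t)` for all `t ≥ 0`. -/
theorem stmt_4
    (f : ℝ → ℝ) (hf_meas : Measurable f)
    (hf_nonneg : ∀ x ∈ Set.Icc (0:ℝ) 1, 0 ≤ f x)
    (hf_bdd : ∃ M : ℝ, ∀ x ∈ Set.Icc (0:ℝ) 1, f x ≤ M)
    (hf_int : ∫ x in Set.Icc (0:ℝ) 1, f x = 1)
    (L : ℝ → ℝ)
    (hL : ∀ t : ℝ, L t = ∫ x in Set.Icc (0:ℝ) 1, Real.exp (-t * x) * f x) :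
    ∃ c : ℝ, 0 < c ∧ ∀ t : ℝ, 0 ≤ t → L t ≤ 1 / (1 + c * t) := by
  obtain ⟨M0, hM0⟩ := hf_bdd
  obtain ⟨M, hM1, hM⟩ : ∃ M : ℝ, 1 ≤ M ∧ ∀ x ∈ Set.Icc (0:ℝ) 1, f x ≤ M :=
    ⟨max M0 1, le_max_right _ _, fun x hx => (hM0 x hx).trans (le_max_left _ _)⟩
  have hMpos : 0 < M := by linarith
  refine ⟨1 / (4 * M), by positivity, fun t ht => ?_⟩
  rcases ht.eq_or_lt with rfl | ht
  · rw [hL]; simp [hf_int]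
  have hfi : IntegrableOn f (Set.Icc (0:ℝ) 1) := by
    by_contra h
    rw [integral_undef h] at hf_int
    norm_num at hf_int
  set a : ℝ := 1 / M with ha
  have ha0 : 0 < a := by positivity
  have ha1 : a ≤ 1 := by rw [ha, div_le_one hMpos]; exact hM1
  have hMa : M * a = 1 := by rw [ha]; field_simp
  set g : ℝ → ℝ := fun x => M * (Real.exp (-t * x) - Real.exp (-(t * a))) with hg
  have hgc : Continuous g := by rw [hg]; fun_prop
  have hgi : IntegrableOn ((Set.Icc (0:ℝ) a).indicator g) (Set.Icc (0:ℝ) 1) :=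
    (hgc.integrableOn_Icc).indicator measurableSet_Icc
  have hri : IntegrableOn (fun x => Real.exp (-(t * a)) * f x) (Set.Icc (0:ℝ) 1) :=
    hfi.const_mul _
  have hli : IntegrableOn (fun x => Real.exp (-t * x) * f x) (Set.Icc (0:ℝ) 1) :=
    IntegrableOn.continuousOn_mul (by fun_prop) hfi isCompact_Icc
  have key : L t ≤ ∫ x in Set.Icc (0:ℝ) 1,
      (Real.exp (-(t * a)) * f x + (Set.Icc (0:ℝ) a).indicator g x) := by
    rw [hL]
    refine setIntegral_mono_on hli (hri.add hgi) measurableSet_Icc fun x hx => ?_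
    have h1 := hf_nonneg x hx
    have h2 := hM x hx
    by_cases hxa : x ≤ a
    · rw [Set.indicator_of_mem (show x ∈ Set.Icc (0:ℝ) a from ⟨hx.1, hxa⟩)]
      have : Real.exp (-(t * a)) ≤ Real.exp (-t * x) := Real.exp_le_exp.2 (by nlinarith)
      simp only [hg]
      nlinarith
    · rw [Set.indicator_of_notMem (fun h => hxa h.2), add_zero]
      have : Real.exp (-t * x) ≤ Real.exp (-(t * a)) := Real.exp_le_exp.2 (by nlinarith)
      exact mul_le_mul_of_nonneg_right this h1
  have hgint : ∫ x in Set.Icc (0:ℝ) 1, (Set.Icc (0:ℝ) a).indicator g x =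
      M * ((1 - Real.exp (-(t * a))) / t - a * Real.exp (-(t * a))) := by
    rw [setIntegral_indicator measurableSet_Icc,
      Set.inter_eq_right.2 (Set.Icc_subset_Icc_right ha1)]
    simp only [hg]
    rw [integral_const_mul, integral_sub, aux_int t a ht ha0.le]
    · simp [ha0.le]
    · exact Continuous.integrableOn_Icc (by fun_prop)
    · exact Continuous.integrableOn_Icc (by fun_prop)
  rw [integral_add hri hgi, integral_const_mul, hf_int, hgint] at key
  have h := aux_ineq (t * a) (by positivity)
  have e1 : Real.exp (-(t * a)) * 1 + M * ((1 - Real.exp (-(t * a))) / t - a * Real.exp (-(t * a)))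
      = (1 - Real.exp (-(t * a))) / (t * a) := by
    have : M = 1 / a := by rw [ha]; field_simp
    rw [this]
    field_simp
    ring
  have e2 : 1 / (4 * M) * t = t * a / 4 := by rw [ha]; field_simp
  rw [e2]
  rw [e1] at key
  exact key.trans h
end

section
/- Let f : [0,1] → [0,∞) be a bounded measurable function with ∫_0^1 f(x) dx = 1, and set 𝓛(t) = ∫_0^1 e^{−t·x} f(x) dx. Then for every t_0 > 0 there exists a constant c_0 > 0 such that for all t ∈ [0, t_0], 𝓛(t) ≤ 1 / (1 + c_0·t). -/
open MeasureTheory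

/-- If `f` is a bounded probability density on `[0,1]` and `𝓛(t) = ∫_0^1 e^{−tx} f(x) dx`, then
for every `t_0 > 0` there exists `c_0 > 0` such that `𝓛(t) ≤ 1 / (1 + c_0·t)` for all
`t ∈ [0, t_0]`. -/
theorem stmt_5
    (f : ℝ → ℝ) (hf_meas : Measurable f)
    (hf_nonneg : ∀ x ∈ Set.Icc (0:ℝ) 1, 0 ≤ f x)
    (hf_bdd : ∃ M : ℝ, ∀ x ∈ Set.Icc (0:ℝ) 1, f x ≤ M)
    (hf_int : ∫ x in Set.Icc (0:ℝ) 1, f x = 1)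
    (L : ℝ → ℝ)
    (hL : ∀ t : ℝ, L t = ∫ x in Set.Icc (0:ℝ) 1, Real.exp (-t * x) * f x) :
    ∀ t₀ : ℝ, 0 < t₀ → ∃ c₀ : ℝ, 0 < c₀ ∧ ∀ t ∈ Set.Icc (0:ℝ) t₀, L t ≤ 1 / (1 + c₀ * t) := by
  intro t₀ ht₀
  have hfi : Integrable f (volume.restrict (Set.Icc (0:ℝ) 1)) := by
    by_contra h
    rw [integral_undef h] at hf_int
    norm_num at hf_int
  have hxi : Integrable (fun x => x * f x) (volume.restrict (Set.Icc (0:ℝ) 1)) := by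
    refine hfi.mono (by fun_prop) ?_
    filter_upwards [ae_restrict_mem measurableSet_Icc] with x hx
    rw [norm_mul, Real.norm_of_nonneg hx.1]
    exact mul_le_of_le_one_left (norm_nonneg _) hx.2
  have hxnn : 0 ≤ᵐ[volume.restrict (Set.Icc (0:ℝ) 1)] (fun x => x * f x) := by
    filter_upwards [ae_restrict_mem measurableSet_Icc] with x hx
    exact mul_nonneg hx.1 (hf_nonneg x hx)
  have hm : 0 < ∫ x in Set.Icc (0:ℝ) 1, x * f x := by
    refine lt_of_le_of_ne (integral_nonneg_of_ae hxnn) (fun h => ?_)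
    have h0 := (integral_eq_zero_iff_of_nonneg_ae hxnn hxi).1 h.symm
    have hne : ∀ᵐ x ∂(volume.restrict (Set.Icc (0:ℝ) 1)), x ≠ 0 :=
      ae_restrict_of_ae (Measure.ae_ne volume 0)
    have hf0 : f =ᵐ[volume.restrict (Set.Icc (0:ℝ) 1)] 0 := by
      filter_upwards [h0, hne] with x hx hx0
      exact (mul_eq_zero.1 hx).resolve_left hx0
    rw [integral_congr_ae hf0] at hf_int
    simp at hf_int
  set m := ∫ x in Set.Icc (0:ℝ) 1, x * f x with hmdef
  have ha : 0 < m / (1 + t₀) := by positivity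
  refine ⟨m / (1 + t₀), ha, fun t ht => ?_⟩
  have hkey : L t ≤ 1 - m / (1 + t₀) * t := by
    have hint : Integrable (fun x => f x - t / (1 + t₀) * (x * f x))
        (volume.restrict (Set.Icc (0:ℝ) 1)) := hfi.sub (hxi.const_mul _)
    have heq : ∫ x in Set.Icc (0:ℝ) 1, (f x - t / (1 + t₀) * (x * f x))
        = 1 - m / (1 + t₀) * t := by
      rw [integral_sub hfi (hxi.const_mul _), integral_const_mul, hf_int, ← hmdef]
      ring
    rw [hL, ← heq]
    refine integral_mono_of_nonneg ?_ hint ?_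
    · filter_upwards [ae_restrict_mem measurableSet_Icc] with x hx
      exact mul_nonneg (Real.exp_pos _).le (hf_nonneg x hx)
    · filter_upwards [ae_restrict_mem measurableSet_Icc] with x hx
      have hu0 : 0 ≤ t * x := mul_nonneg ht.1 hx.1
      have hu1 : t * x ≤ t₀ := (mul_le_of_le_one_right ht.1 hx.2).trans ht.2
      have h1 : Real.exp (-t * x) ≤ 1 / (1 + t * x) := by
        rw [neg_mul, Real.exp_neg, ← one_div]
        apply one_div_le_one_div_of_le (by positivity)
        linarith [Real.add_one_le_exp (t * x)]
      have h2 : 1 / (1 + t * x) ≤ 1 - t * x / (1 + t₀) := by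
        rw [div_le_iff₀ (by positivity)]
        have h3 : (1 - t * x / (1 + t₀)) * (1 + t * x)
            = 1 + t * x * (t₀ - t * x) / (1 + t₀) := by
          field_simp
          ring
        rw [h3]
        have : 0 ≤ t₀ - t * x := by linarith
        have : 0 ≤ t * x * (t₀ - t * x) / (1 + t₀) := by positivity
        linarith
      calc Real.exp (-t * x) * f x ≤ (1 - t * x / (1 + t₀)) * f x :=
            mul_le_mul_of_nonneg_right (h1.trans h2) (hf_nonneg x hx)
        _ = f x - t / (1 + t₀) * (x * f x) := by ring
  refine hkey.trans ?_
  have hat : 0 ≤ m / (1 + t₀) * t := mul_nonneg ha.le ht.1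
  rw [le_div_iff₀ (by linarith)]
  nlinarith [sq_nonneg (m / (1 + t₀) * t)]
end

section
/- Let f : [0,1] → [0,∞) be a bounded measurable function with ∫_0^1 f(x) dx = 1, and set 𝓛(t) = ∫_0^1 e^{−t·x} f(x) dx for t ≥ 0. Then there exist constants c_∞ > 0 and t_∞ > 0 such that for all t ≥ t_∞, 𝓛(t) ≤ 1 / (1 + c_∞·t). -/
open MeasureTheory

/-- If `f` is a bounded probability density on `[0,1]` and `𝓛(t) = ∫_0^1 e^{−tx} f(x) dx`, then
there exist constants `c_∞ > 0` and `t_∞ > 0` such that `𝓛(t) ≤ 1 / (1 + c_∞·t)` for all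
`t ≥ t_∞`. -/
theorem stmt_7
    (f : ℝ → ℝ) (hf_meas : Measurable f)
    (hf_nonneg : ∀ x ∈ Set.Icc (0:ℝ) 1, 0 ≤ f x)
    (hf_bdd : ∃ M : ℝ, ∀ x ∈ Set.Icc (0:ℝ) 1, f x ≤ M)
    (hf_int : ∫ x in Set.Icc (0:ℝ) 1, f x = 1)
    (L : ℝ → ℝ)
    (hL : ∀ t : ℝ, L t = ∫ x in Set.Icc (0:ℝ) 1, Real.exp (-t * x) * f x) :
    ∃ cInf tInf : ℝ, 0 < cInf ∧ 0 < tInf ∧ ∀ t : ℝ, tInf ≤ t → L t ≤ 1 / (1 + cInf * t) := by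
  obtain ⟨M, hM⟩ := hf_bdd
  obtain ⟨K, hK, hKM⟩ : ∃ K : ℝ, 0 < K ∧ M ≤ K :=
    ⟨max M 1, lt_of_lt_of_le one_pos (le_max_right _ _), le_max_left _ _⟩
  refine ⟨1 / (2 * K), 2 * K, by positivity, by positivity, fun t ht => ?_⟩
  have ht0 : 0 < t := by linarith
  have h1 : L t ≤ ∫ x in Set.Icc (0:ℝ) 1, Real.exp (-t * x) * K := by
    rw [hL]
    apply integral_mono_of_nonneg
    · filter_upwards [ae_restrict_mem measurableSet_Icc] with x hx
      exact mul_nonneg (Real.exp_pos _).le (hf_nonneg x hx)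
    · exact (Continuous.continuousOn (by fun_prop)).integrableOn_compact isCompact_Icc
    · filter_upwards [ae_restrict_mem measurableSet_Icc] with x hx
      exact mul_le_mul_of_nonneg_left ((hM x hx).trans hKM) (Real.exp_pos _).le
  have h2 : ∫ x in Set.Icc (0:ℝ) 1, Real.exp (-t * x) * K
      = -(K / t) * Real.exp (-t * 1) - -(K / t) * Real.exp (-t * 0) := by
    rw [integral_Icc_eq_integral_Ioc, ← intervalIntegral.integral_of_le zero_le_one]
    refine intervalIntegral.integral_eq_sub_of_hasDerivAt
      (f := fun x => -(K / t) * Real.exp (-t * x)) (fun x _ => ?_)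
      (Continuous.intervalIntegrable (by fun_prop) _ _)
    have h := ((((hasDerivAt_id' x).const_mul (-t)).exp).const_mul (-(K / t)))
    have e : -(K / t) * (Real.exp (-t * x) * (-t * 1)) = Real.exp (-t * x) * K := by
      field_simp
    rw [← e]
    exact h
  have h3 : L t ≤ K / t := by
    rw [h2] at h1
    have : 0 < K / t * Real.exp (-t * 1) := by positivity
    simp only [mul_zero, Real.exp_zero] at h1
    linarith
  refine h3.trans ?_
  rw [div_le_div_iff₀ ht0 (by positivity)]
  have : K * (1 + 1 / (2 * K) * t) = K + t / 2 := by field_simp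
  rw [this]
  linarith
end

section
/- For every integer N ≥ 2, setting t = 2·log N, one has (N^{-1}·e^{−t}) / (N^{-1}·e^{−t} + ((N−1)/N)·e^{−2t}) ≥ 1 / (1 + 1/N). -/
/-- For every integer `N ≥ 2`, with `t = 2·log N`, one has
`(N⁻¹ e^{−t}) / (N⁻¹ e^{−t} + ((N−1)/N) e^{−2t}) ≥ 1 / (1 + 1/N)`. -/
theorem stmt_9 (N : ℕ) (hN : 2 ≤ N) :
    ((N : ℝ)⁻¹ * Real.exp (-(2 * Real.log N))) /
        ((N : ℝ)⁻¹ * Real.exp (-(2 * Real.log N)) +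
          (((N : ℝ) - 1) / (N : ℝ)) * Real.exp (-(2 * (2 * Real.log N))))
      ≥ 1 / (1 + 1 / (N : ℝ)) := by
  have hx : (0 : ℝ) < N := by
    have : 0 < N := by omega
    exact_mod_cast this
  have hx1 : (1 : ℝ) ≤ N := by
    have : 1 ≤ N := by omega
    exact_mod_cast this
  have e1 : Real.exp (-(2 * Real.log N)) = (N : ℝ)⁻¹ ^ 2 := by
    rw [show -(2 * Real.log N) = -Real.log N + -Real.log N by ring, Real.exp_add,
      Real.exp_neg, Real.exp_log hx]
    ring
  have e2 : Real.exp (-(2 * (2 * Real.log N))) = (N : ℝ)⁻¹ ^ 4 := by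
    rw [show -(2 * (2 * Real.log N)) = -(2 * Real.log N) + -(2 * Real.log N) by ring,
      Real.exp_add, e1]
    ring
  rw [e1, e2, div_eq_mul_inv ((N : ℝ) - 1), one_div (N : ℝ), ge_iff_le]
  have ha : 0 < (N : ℝ)⁻¹ := inv_pos.mpr hx
  have hxa : (N : ℝ) * (N : ℝ)⁻¹ = 1 := mul_inv_cancel₀ hx.ne'
  generalize (N : ℝ)⁻¹ = a at *
  have h0 : ((N : ℝ) - 1) * a = 1 - a := by linarith
  have h1 : 0 ≤ 1 - a := by
    rw [← h0]
    exact mul_nonneg (by linarith) ha.le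
  rw [h0, div_le_div_iff₀ (by positivity) (by positivity)]
  have h5 : 0 < a ^ 5 := by positivity
  nlinarith
end
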